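/- Let β ∈ (0,1/4] and let H : [0,1] → [H̲,H̄] with 1/α < H̲ ≤ H̄ < 1 satisfy |H(t₁) − H(t₂)| ≤ c_H |t₁ − t₂|^{ρ_H} for all t₁,t₂ ∈ [0,1], where c_H > 0 and H̄ < ρ_H ≤ 1. Then there exists a constant c > 0 (not depending on I and N) such that for every compact interval I ⊆ [0,1] and every integer N ≥ 4 with λ(I) ≥ 4(L+1) N^{−1} (log N)², one has | Σ_{m ∈ ν_{2N}(I)} ‖Φ_α(·, H(m/(2N)))‖_{L^α(ℝ)}^β (2N)^{−β H(m/(2N))} − 2 Σ_{k ∈ ν_N(I)} ‖Φ_α(·, H(k/N))‖_{L^α(ℝ)}^β (2N)^{−β H(k/N)} | ≤ c · N^{−β H̲(I)} · (1 + |ν_N(I)| · N^{−β ρ_H} · log N), where H̲(I) = min_{t ∈ I} H(t). -/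

import Mathlib

open MeasureTheory
open scoped Classical

/-- `(x)_+^κ = x^κ` if `x > 0`, and `0` otherwise. -/
noncomputable def posPow (x κ : ℝ) : ℝ := if 0 < x then x ^ κ else 0

/-- `Φ_α(u,v) = Σ_{l=0}^L a_l (l−u)_+^{v−1/α}` with `a_l = (−1)^{L−l}·(L choose l)`. -/
noncomputable def Phi (α : ℝ) (L : ℕ) (u v : ℝ) : ℝ :=
  ∑ l ∈ Finset.range (L + 1),
    ((-1 : ℝ) ^ (L - l) * (L.choose l : ℝ)) * posPow ((l : ℝ) - u) (v - 1 / α)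

/-- `‖Φ_α(·,v)‖_{L^α(ℝ)} = (∫_ℝ |Φ_α(u,v)|^α du)^{1/α}`. -/
noncomputable def PhiNorm (α : ℝ) (L : ℕ) (v : ℝ) : ℝ :=
  (∫ u : ℝ, |Phi α L u v| ^ α) ^ (1 / α)

/-- Mean value inequality in the exponent for powers with exponents in `[a, b] ⊆ (0, 1)`. -/
lemma abs_rpow_sub_rpow_exponent_le {a b κ κ' y : ℝ} (ha : 0 < a) (hb : b ≤ 1)
    (hκ : κ ∈ Set.Icc a b) (hκ' : κ' ∈ Set.Icc a b) (hy : 0 < y) :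
    |y ^ κ - y ^ κ'| ≤ (1 / a + (1 + y) ^ 2) * |κ - κ'| := by
  refine Convex.norm_image_sub_le_of_norm_hasDerivWithin_le (f := fun κ => y ^ κ)
    (f' := fun κ => y ^ κ * Real.log y) (s := Set.Icc a b)
    (fun x _ => (Real.hasStrictDerivAt_const_rpow hy x).hasDerivAt.hasDerivWithinAt) ?_
    (convex_Icc a b) hκ' hκ
  intro x hx
  rw [Real.norm_eq_abs]
  rcases le_total y 1 with h | h
  · have h3 := Real.abs_log_mul_self_rpow_lt y x hy h (ha.trans_le hx.1)
    have h4 : 1 / x ≤ 1 / a := one_div_le_one_div_of_le ha hx.1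
    rw [mul_comm]
    nlinarith [sq_nonneg (1 + y)]
  · have h5 : y ^ x ≤ y := by
      simpa using Real.rpow_le_rpow_of_exponent_le h (hx.2.trans hb)
    have h6 : Real.log y ≤ y := (Real.log_le_sub_one_of_pos hy).trans (by linarith)
    have h7 : 0 ≤ Real.log y := Real.log_nonneg h
    rw [abs_of_nonneg (mul_nonneg (Real.rpow_nonneg hy.le _) h7)]
    have h8 : y ^ x * Real.log y ≤ y * y := mul_le_mul h5 h6 h7 hy.le
    have h9 : 0 < 1 / a := by positivity
    nlinarith

/-- Mean value inequality in the exponent for the derivatives of powers. -/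
lemma abs_mul_rpow_sub_mul_rpow_exponent_le {b ε κ κ' y : ℝ} (hb : b ≤ 1) (hε : 0 < ε)
    (hκ : κ ∈ Set.Icc 0 b) (hκ' : κ' ∈ Set.Icc 0 b) (hy : 1 ≤ y) :
    |κ * y ^ (κ - 1) - κ' * y ^ (κ' - 1)| ≤ (1 + 1 / ε) * y ^ (b - 1 + ε) * |κ - κ'| := by
  have hy0 : 0 < y := by linarith
  refine Convex.norm_image_sub_le_of_norm_hasDerivWithin_le (f := fun κ => κ * y ^ (κ - 1))
    (f' := fun κ => y ^ (κ - 1) * (1 + κ * Real.log y)) (s := Set.Icc 0 b)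
    ?_ ?_ (convex_Icc 0 b) hκ' hκ
  · intro x _
    have h := (hasDerivAt_id x).mul
      ((Real.hasStrictDerivAt_const_rpow hy0 (x - 1)).hasDerivAt.comp x
        ((hasDerivAt_id x).sub_const 1))
    refine (h.congr_deriv ?_).hasDerivWithinAt
    simp
    ring
  · intro x hx
    have h7 : 0 ≤ Real.log y := Real.log_nonneg hy
    have h8 : Real.log y ≤ y ^ ε / ε := Real.log_le_rpow_div hy0.le hε
    have h9 : 1 ≤ y ^ ε := Real.one_le_rpow hy hε.le
    rw [Real.norm_eq_abs, abs_of_nonneg (mul_nonneg (Real.rpow_nonneg hy0.le _)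
      (by nlinarith [mul_nonneg hx.1 h7]))]
    have h10 : y ^ (b - 1 + ε) = y ^ (b - 1) * y ^ ε := Real.rpow_add hy0 _ _
    have h11 : y ^ (x - 1) ≤ y ^ (b - 1) :=
      Real.rpow_le_rpow_of_exponent_le hy (by linarith [hx.2])
    have h12 : x * Real.log y ≤ y ^ ε / ε := by nlinarith [hx.2, hx.1]
    have h13 : 1 + x * Real.log y ≤ (1 + 1 / ε) * y ^ ε := by
      have : (1 + 1 / ε) * y ^ ε = y ^ ε + y ^ ε / ε := by ring
      linarith
    rw [h10]
    calc _ ≤ y ^ (b - 1) * ((1 + 1 / ε) * y ^ ε) :=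
          mul_le_mul h11 h13 (by nlinarith [mul_nonneg hx.1 h7]) (Real.rpow_nonneg hy0.le _)
      _ = _ := by ring

/-- Increment of the difference of two powers between `x` and `x + l`. -/
lemma abs_increment_rpow_sub_rpow_le {b ε κ κ' x l : ℝ} (hb : b ≤ 1) (hε : 0 < ε)
    (hbε : b - 1 + ε ≤ 0) (hκ : κ ∈ Set.Icc 0 b) (hκ' : κ' ∈ Set.Icc 0 b) (hx : 1 ≤ x)
    (hl : 0 ≤ l) :
    |((x + l) ^ κ - (x + l) ^ κ') - (x ^ κ - x ^ κ')| ≤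
      (1 + 1 / ε) * x ^ (b - 1 + ε) * |κ - κ'| * l := by
  have h := Convex.norm_image_sub_le_of_norm_hasDerivWithin_le
    (f := fun y : ℝ => y ^ κ - y ^ κ')
    (f' := fun y => κ * y ^ (κ - 1) - κ' * y ^ (κ' - 1)) (s := Set.Ici x)
    (C := (1 + 1 / ε) * x ^ (b - 1 + ε) * |κ - κ'|) (x := x) (y := x + l) ?_ ?_
    (convex_Ici x) Set.self_mem_Ici (by simpa using hl)
  · simpa [Real.norm_eq_abs, abs_of_nonneg hl] using h
  · intro y hy
    have hy0 : y ≠ 0 := ne_of_gt <| by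
      have : x ≤ y := hy
      linarith
    exact ((Real.hasDerivAt_rpow_const (Or.inl hy0)).sub
      (Real.hasDerivAt_rpow_const (Or.inl hy0))).hasDerivWithinAt
  · intro y hy
    have hxy : x ≤ y := hy
    refine (abs_mul_rpow_sub_mul_rpow_exponent_le hb hε hκ hκ' (hx.trans hxy)).trans ?_
    have := Real.rpow_le_rpow_of_nonpos (by linarith) hxy hbε
    gcongr

lemma sum_alternating_choose_eq_zero {L : ℕ} (hL : L ≠ 0) :
    ∑ l ∈ Finset.range (L + 1), ((-1 : ℝ) ^ (L - l) * (L.choose l : ℝ)) = 0 := by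
  have h := add_pow (1 : ℝ) (-1) L
  simpa [hL] using h.symm

lemma measurable_Phi (α : ℝ) (L : ℕ) (v : ℝ) : Measurable fun u => Phi α L u v := by
  unfold Phi posPow
  refine Finset.measurable_fun_sum _ fun l _ => Measurable.const_mul (Measurable.ite ?_ ?_ ?_) _
  · exact measurableSet_lt measurable_const (by fun_prop)
  · fun_prop
  · fun_prop

lemma Phi_sub_Phi (α : ℝ) (L : ℕ) (u v v' : ℝ) :
    Phi α L u v - Phi α L u v' = ∑ l ∈ Finset.range (L + 1),
      ((-1 : ℝ) ^ (L - l) * (L.choose l : ℝ)) *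
        (posPow ((l : ℝ) - u) (v - 1 / α) - posPow ((l : ℝ) - u) (v' - 1 / α)) := by
  simp only [Phi, mul_sub, Finset.sum_sub_distrib]

lemma abs_alternating_choose (L l : ℕ) :
    |(-1 : ℝ) ^ (L - l) * (L.choose l : ℝ)| = L.choose l := by
  simp [abs_mul]

lemma sum_choose_real (L : ℕ) :
    ∑ l ∈ Finset.range (L + 1), (L.choose l : ℝ) = 2 ^ L := by
  exact_mod_cast Nat.sum_range_choose L

/-- `Φ_α(u, ·)` is Lipschitz, with a constant decaying like an `α`-integrable power of `1 + |u|`. -/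
lemma exists_abs_Phi_sub_le {α Hlow Hup : ℝ} (hα : 1 < α) {L : ℕ} (hL : L ≠ 0)
    (h0 : 1 / α < Hlow) (h2 : Hup < 1) :
    ∃ C > (0 : ℝ), ∀ v ∈ Set.Icc Hlow Hup, ∀ v' ∈ Set.Icc Hlow Hup, ∀ u : ℝ,
      |Phi α L u v - Phi α L u v'| ≤
        C * |v - v'| * (1 + |u|) ^ (-(1 / α + (1 - Hup) / 2)) := by
  have hα0 : 0 < 1 / α := by positivity
  set a := Hlow - 1 / α with ha
  set b := Hup - 1 / α with hb
  set ε := (1 - Hup) / 2 with hε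
  set p := -(1 / α + ε) with hp
  have ha0 : 0 < a := by linarith
  have hε0 : 0 < ε := by linarith
  have hp0 : p < 0 := by linarith
  have hpb : b - 1 + ε = p := by rw [hp, hb, hε]; ring
  have hb1 : b ≤ 1 := by linarith
  set C₁ := 2 ^ L * (1 / a + (1 + ((L : ℝ) + 1)) ^ 2) with hC₁
  set C₂ := 2 ^ L * ((1 + 1 / ε) * L) with hC₂
  refine ⟨C₁ / (1 + (L : ℝ)) ^ p + C₂ / 2 ^ p, by positivity, fun v hv v' hv' u => ?_⟩
  have hκ : v - 1 / α ∈ Set.Icc a b := ⟨by linarith [hv.1], by linarith [hv.2]⟩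
  have hκ' : v' - 1 / α ∈ Set.Icc a b := ⟨by linarith [hv'.1], by linarith [hv'.2]⟩
  have hvv : |v - 1 / α - (v' - 1 / α)| = |v - v'| := by congr 1; ring
  have hu0 : 0 < 1 + |u| := by positivity
  rcases le_or_gt u (-1) with hu | hu
  · have hau : |u| = -u := abs_of_nonpos (by linarith)
    have hkey : |Phi α L u v - Phi α L u v'| ≤ C₂ * (-u) ^ p * |v - v'| := by
      have hz : Phi α L u v - Phi α L u v' = ∑ l ∈ Finset.range (L + 1),
          ((-1 : ℝ) ^ (L - l) * (L.choose l : ℝ)) *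
          (((-u + l) ^ (v - 1 / α) - (-u + l) ^ (v' - 1 / α)) -
            ((-u) ^ (v - 1 / α) - (-u) ^ (v' - 1 / α))) := by
        have hs := sum_alternating_choose_eq_zero hL
        rw [Phi_sub_Phi]
        simp_rw [mul_sub _ (_ - _) ((-u) ^ (v - 1 / α) - (-u) ^ (v' - 1 / α))]
        rw [Finset.sum_sub_distrib, ← Finset.sum_mul, hs, zero_mul, sub_zero]
        refine Finset.sum_congr rfl fun l _ => ?_
        have h1 : (0 : ℝ) < l - u := by have : (0 : ℝ) ≤ l := l.cast_nonneg; linarith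
        simp only [posPow, h1, if_true]
        rw [neg_add_eq_sub]
      rw [hz]
      refine (Finset.abs_sum_le_sum_abs _ _).trans ?_
      have hterm : ∀ l ∈ Finset.range (L + 1), |((-1 : ℝ) ^ (L - l) * (L.choose l : ℝ)) *
          (((-u + l) ^ (v - 1 / α) - (-u + l) ^ (v' - 1 / α)) -
            ((-u) ^ (v - 1 / α) - (-u) ^ (v' - 1 / α)))| ≤
          (L.choose l : ℝ) * ((1 + 1 / ε) * (-u) ^ p * |v - v'| * L) := by
        intro l hl
        rw [abs_mul, abs_alternating_choose]
        have h1 := abs_increment_rpow_sub_rpow_le hb1 hε0 (hpb.trans_le hp0.le)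
          ⟨ha0.le.trans hκ.1, hκ.2⟩ ⟨ha0.le.trans hκ'.1, hκ'.2⟩
          (show 1 ≤ -u by linarith) (Nat.cast_nonneg (α := ℝ) l)
        rw [hpb, hvv] at h1
        have hlL : (l : ℝ) ≤ L := by
          exact_mod_cast Nat.lt_succ_iff.mp (Finset.mem_range.mp hl)
        have hun : 0 ≤ -u := by linarith
        gcongr
        refine h1.trans ?_
        gcongr
      refine (Finset.sum_le_sum hterm).trans_eq ?_
      rw [← Finset.sum_mul, sum_choose_real, hC₂]
      ring
    have h3 : 2 ^ p * (-u) ^ p ≤ (1 + |u|) ^ p := by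
      rw [← Real.mul_rpow (by norm_num) (by linarith)]
      exact Real.rpow_le_rpow_of_nonpos hu0 (by rw [hau]; linarith) hp0.le
    have h4 : (-u) ^ p ≤ (1 + |u|) ^ p / 2 ^ p := by
      rw [le_div_iff₀ (by positivity)]; linarith
    calc _ ≤ C₂ * (-u) ^ p * |v - v'| := hkey
      _ ≤ C₂ * ((1 + |u|) ^ p / 2 ^ p) * |v - v'| := by gcongr
      _ = C₂ / 2 ^ p * |v - v'| * (1 + |u|) ^ p := by ring
      _ ≤ _ := by
        gcongr
        have : 0 ≤ C₁ / (1 + (L : ℝ)) ^ p := by positivity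
        linarith
  · rcases le_or_gt u L with huL | huL
    · have hkey : |Phi α L u v - Phi α L u v'| ≤ C₁ * |v - v'| := by
        rw [Phi_sub_Phi]
        refine (Finset.abs_sum_le_sum_abs _ _).trans ?_
        have hterm : ∀ l ∈ Finset.range (L + 1), |((-1 : ℝ) ^ (L - l) * (L.choose l : ℝ)) *
            (posPow ((l : ℝ) - u) (v - 1 / α) - posPow ((l : ℝ) - u) (v' - 1 / α))| ≤
            (L.choose l : ℝ) * ((1 / a + (1 + ((L : ℝ) + 1)) ^ 2) * |v - v'|) := by
          intro l hl
          have hlL : (l : ℝ) ≤ L := by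
            exact_mod_cast Nat.lt_succ_iff.mp (Finset.mem_range.mp hl)
          rw [abs_mul, abs_alternating_choose]
          gcongr
          unfold posPow
          split_ifs with h
          · refine (abs_rpow_sub_rpow_exponent_le ha0 hb1 hκ hκ' h).trans ?_
            rw [hvv]
            gcongr
            linarith
          · simp only [sub_self, abs_zero]; positivity
        refine (Finset.sum_le_sum hterm).trans_eq ?_
        rw [← Finset.sum_mul, sum_choose_real, hC₁]
        ring
      have hL1 : (1 : ℝ) ≤ L := by exact_mod_cast Nat.one_le_iff_ne_zero.mpr hL
      have h3 : (1 + (L : ℝ)) ^ p ≤ (1 + |u|) ^ p :=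
        Real.rpow_le_rpow_of_nonpos hu0 (by
          have : |u| ≤ L := abs_le.mpr ⟨by linarith, huL⟩
          linarith) hp0.le
      have h5 : C₁ ≤ C₁ / (1 + (L : ℝ)) ^ p * (1 + |u|) ^ p := by
        rw [div_mul_eq_mul_div, le_div_iff₀ (by positivity)]
        gcongr
      calc _ ≤ C₁ * |v - v'| := hkey
        _ ≤ C₁ / (1 + (L : ℝ)) ^ p * (1 + |u|) ^ p * |v - v'| := by gcongr
        _ = C₁ / (1 + (L : ℝ)) ^ p * |v - v'| * (1 + |u|) ^ p := by ring
        _ ≤ _ := by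
          gcongr
          have : 0 ≤ C₂ / (2 : ℝ) ^ p := by positivity
          linarith
    · have hzero : Phi α L u v - Phi α L u v' = 0 := by
        rw [Phi_sub_Phi]
        refine Finset.sum_eq_zero fun l hl => ?_
        have hlL : (l : ℝ) ≤ L := by
          exact_mod_cast Nat.lt_succ_iff.mp (Finset.mem_range.mp hl)
        simp [posPow, not_lt.mpr (show (l : ℝ) - u ≤ 0 by linarith)]
      rw [hzero, abs_zero]
      positivity

/-- If `|f - g|` is dominated by an `L^p` function, the `L^p` norms of `f` and `g` are close,
whether or not `f` and `g` are themselves in `L^p`. -/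
lemma abs_lpNorm_sub_lpNorm_le {f g G : ℝ → ℝ} {p : ENNReal} (hp : 1 ≤ p)
    (hf : AEStronglyMeasurable f) (hg : AEStronglyMeasurable g) (hG : MemLp G p)
    (hfg : ∀ x, |f x - g x| ≤ G x) :
    |lpNorm f p volume - lpNorm g p volume| ≤ lpNorm G p volume := by
  have hd : MemLp (f - g) p := hG.mono' (hf.sub hg) (Filter.Eventually.of_forall hfg)
  have hle : lpNorm (f - g) p volume ≤ lpNorm G p volume := lpNorm_mono_real hG hfg
  by_cases h : MemLp g p
  · have hf' : MemLp f p := by simpa using hd.add h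
    have h1 := lpNorm_le_lpNorm_add_lpNorm_sub' h hp (f := f)
    have h2 := lpNorm_le_lpNorm_add_lpNorm_sub' hf' hp (f := g)
    rw [lpNorm_sub_comm g f] at h2
    rw [abs_sub_le_iff]
    constructor <;> linarith
  · have hf' : ¬ MemLp f p := fun hf' => h (by simpa using hf'.sub hd)
    rw [lpNorm_of_not_memLp h, lpNorm_of_not_memLp hf']
    simp

lemma PhiNorm_eq_lpNorm {α : ℝ} (hα : 0 < α) (L : ℕ) (v : ℝ) :
    PhiNorm α L v = lpNorm (fun u => Phi α L u v) (ENNReal.ofReal α) volume := by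
  rw [lpNorm_eq_integral_norm_rpow_toReal (by simpa using hα) ENNReal.ofReal_ne_top
    (measurable_Phi α L v).aestronglyMeasurable]
  simp [PhiNorm, ENNReal.toReal_ofReal hα.le]

lemma PhiNorm_nonneg (α : ℝ) (L : ℕ) (v : ℝ) : 0 ≤ PhiNorm α L v := by
  unfold PhiNorm
  positivity

lemma exists_abs_PhiNorm_sub_le {α Hlow Hup : ℝ} (hα : 1 < α) {L : ℕ} (hL : L ≠ 0)
    (h0 : 1 / α < Hlow) (h2 : Hup < 1) :
    ∃ C > (0 : ℝ), ∀ v ∈ Set.Icc Hlow Hup, ∀ v' ∈ Set.Icc Hlow Hup,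
      |PhiNorm α L v - PhiNorm α L v'| ≤ C * |v - v'| := by
  obtain ⟨C, hC, h⟩ := exists_abs_Phi_sub_le hα hL h0 h2
  have hα0 : 0 < α := by linarith
  set p := ENNReal.ofReal α with hp
  set q := 1 / α + (1 - Hup) / 2 with hq
  have hG : MemLp (fun u : ℝ => (1 + |u|) ^ (-q)) p := by
    have hm : AEStronglyMeasurable (fun u : ℝ => (1 + |u|) ^ (-q)) volume := by
      apply Measurable.aestronglyMeasurable
      fun_prop
    rw [← integrable_norm_rpow_iff hm (by simpa [hp] using hα0) ENNReal.ofReal_ne_top]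
    have hr : ((Module.finrank ℝ ℝ : ℕ) : ℝ) < q * α := by
      have : q * α = 1 + (1 - Hup) / 2 * α := by rw [hq]; field_simp
      simp only [Module.finrank_self, Nat.cast_one]
      nlinarith
    refine (integrable_one_add_norm (E := ℝ) (μ := volume) hr).congr
      (Filter.Eventually.of_forall fun u => ?_)
    simp only
    rw [ENNReal.toReal_ofReal hα0.le, Real.norm_eq_abs, Real.norm_eq_abs,
      abs_of_nonneg (show 0 ≤ (1 + |u|) ^ (-q) by positivity), ← Real.rpow_mul (by positivity)]
    congr 1
    ring
  refine ⟨C * (lpNorm (fun u : ℝ => (1 + |u|) ^ (-q)) p volume + 1),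
    by have := lpNorm_nonneg (f := fun u : ℝ => (1 + |u|) ^ (-q)) (p := p) (μ := volume)
       positivity, fun v hv v' hv' => ?_⟩
  rw [PhiNorm_eq_lpNorm hα0, PhiNorm_eq_lpNorm hα0]
  refine (abs_lpNorm_sub_lpNorm_le (by simpa [hp] using hα.le)
    (measurable_Phi α L v).aestronglyMeasurable (measurable_Phi α L v').aestronglyMeasurable
    (hG.const_smul (C * |v - v'|)) (by simpa using h v hv v' hv')).trans ?_
  rw [lpNorm_const_smul, coe_nnnorm, Real.norm_eq_abs, abs_of_nonneg (by positivity)]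
  have : 0 ≤ C * |v - v'| := by positivity
  nlinarith

lemma sum_range_two_mul (f : ℕ → ℝ) (n : ℕ) :
    ∑ m ∈ Finset.range (2 * n), f m = ∑ k ∈ Finset.range n, (f (2 * k) + f (2 * k + 1)) := by
  induction n with
  | zero => simp
  | succ n ih =>
    rw [Finset.sum_range_succ, ← ih, Nat.mul_succ, Finset.sum_range_succ, Finset.sum_range_succ]
    ring

/-- Comparison of a sum over `t` with twice the sum over the halved even indices in `s`, when
outside of an exceptional set `E` the two index sets match. -/
lemma abs_sum_sub_two_mul_sum_le {F : ℕ → ℝ} {s t E : Finset ℕ} {n : ℕ} {M δ : ℝ}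
    (hM : 0 ≤ M) (hδ : 0 ≤ δ) (hs : s ⊆ Finset.range n) (ht : t ⊆ Finset.range (2 * n))
    (hst : ∀ k ∈ s, 2 * k ∈ t) (hE : ∀ k ∉ E, (k ∈ s ↔ 2 * k ∈ t) ∧ (k ∈ s ↔ 2 * k + 1 ∈ t))
    (hF : ∀ m ∈ t, |F m| ≤ M)
    (hFδ : ∀ k ∈ s, 2 * k + 1 ∈ t → |F (2 * k + 1) - F (2 * k)| ≤ δ) :
    |∑ m ∈ t, F m - 2 * ∑ k ∈ s, F (2 * k)| ≤ s.card * δ + E.card * (2 * M) := by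
  have e1 : ∑ m ∈ t, F m = ∑ m ∈ Finset.range (2 * n), if m ∈ t then F m else 0 := by
    rw [← Finset.sum_filter, Finset.filter_mem_eq_inter, Finset.inter_eq_right.mpr ht]
  have e2 : ∑ k ∈ s, F (2 * k) = ∑ k ∈ Finset.range n, if k ∈ s then F (2 * k) else 0 := by
    rw [← Finset.sum_filter, Finset.filter_mem_eq_inter, Finset.inter_eq_right.mpr hs]
  have e3 : (s.card : ℝ) * δ = ∑ k ∈ Finset.range n, if k ∈ s then δ else 0 := by
    rw [← Finset.sum_filter, Finset.filter_mem_eq_inter, Finset.inter_eq_right.mpr hs]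
    simp
  have e4 : ∑ k ∈ Finset.range n, (if k ∈ E then 2 * M else 0) ≤ E.card * (2 * M) := by
    rw [← Finset.sum_filter, Finset.filter_mem_eq_inter, Finset.sum_const, nsmul_eq_mul]
    gcongr
    exact Finset.inter_subset_right
  rw [e1, e2, e3, sum_range_two_mul, Finset.mul_sum, ← Finset.sum_sub_distrib]
  refine ((Finset.abs_sum_le_sum_abs _ _).trans ?_).trans (add_le_add_right e4 _)
  rw [← Finset.sum_add_distrib]
  refine Finset.sum_le_sum fun k _ => ?_
  have a1 := hst k
  have a2 := hE k
  have a3 := fun h => abs_le.mp (hF (2 * k) h)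
  have a4 := fun h => abs_le.mp (hF (2 * k + 1) h)
  have a5 := fun h h' => abs_le.mp (hFδ k h h')
  clear hF hFδ hst hE e1 e2 e3 e4
  rw [abs_le]
  split_ifs <;> grind

/-- Lipschitz bound for `a ↦ X ^ (-(β * a))` on `[h, ∞)`. -/
lemma abs_rpow_neg_mul_sub_le {X β h a a' : ℝ} (hX : 1 ≤ X) (hβ : 0 ≤ β) (ha : h ≤ a)
    (ha' : h ≤ a') :
    |X ^ (-(β * a)) - X ^ (-(β * a'))| ≤ X ^ (-(β * h)) * (β * Real.log X) * |a - a'| := by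
  have hX0 : 0 < X := by linarith
  have hlog := Real.log_nonneg hX
  refine Convex.norm_image_sub_le_of_norm_hasDerivWithin_le (f := fun a => X ^ (-(β * a)))
    (f' := fun a => X ^ (-(β * a)) * Real.log X * (-β)) (s := Set.Ici h)
    ?_ ?_ (convex_Ici h) ha' ha
  · intro x _
    have h1 : HasDerivAt (fun a : ℝ => -(β * a)) (-β) x := by
      have h2 := (hasDerivAt_id x).const_mul (-β)
      simp only [mul_one, id_eq, neg_mul] at h2
      exact h2
    exact ((Real.hasStrictDerivAt_const_rpow hX0 (-(β * x))).hasDerivAt.comp x h1).hasDerivWithinAt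
  · intro x hx
    have hx' : h ≤ x := hx
    rw [Real.norm_eq_abs, mul_assoc, abs_mul, abs_of_pos (Real.rpow_pos_of_pos hX0 _), abs_mul,
      abs_neg, abs_of_nonneg hβ, abs_of_nonneg hlog, mul_comm (Real.log X)]
    have : X ^ (-(β * x)) ≤ X ^ (-(β * h)) :=
      Real.rpow_le_rpow_of_exponent_le hX (neg_le_neg (by gcongr))
    gcongr

lemma abs_rpow_sub_rpow_le_abs_sub_rpow {x y β : ℝ} (hx : 0 ≤ x) (hy : 0 ≤ y) (hβ : 0 ≤ β)
    (hβ1 : β ≤ 1) : |x ^ β - y ^ β| ≤ |x - y| ^ β := by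
  wlog hxy : y ≤ x generalizing x y
  · rw [abs_sub_comm, abs_sub_comm x]
    exact this hy hx (le_of_not_ge hxy)
  have h := Real.rpow_add_le_add_rpow (sub_nonneg.mpr hxy) hy hβ hβ1
  rw [sub_add_cancel] at h
  rw [abs_of_nonneg (sub_nonneg.mpr (Real.rpow_le_rpow hy hxy hβ)),
    abs_of_nonneg (sub_nonneg.mpr hxy)]
  linarith

/-- The indices near the ends of `[u, w]`, and near `N`, at which the grids of mesh `1 / N` and
`1 / (2 * N)` restricted to `[u, w]` may fail to match. -/
noncomputable def exceptionalIndices (L N : ℕ) (u w : ℝ) : Finset ℕ :=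
  {⌊w * N⌋₊, ⌈u * N⌉₊ - 1} ∪ Finset.Ioo (N - L) N

lemma card_exceptionalIndices_le (L N : ℕ) (u w : ℝ) :
    (exceptionalIndices L N u w).card ≤ L + 2 := by
  refine (Finset.card_union_le _ _).trans ?_
  have h1 := Finset.card_le_two (a := ⌊w * N⌋₊) (b := ⌈u * N⌉₊ - 1)
  have h2 : (Finset.Ioo (N - L) N).card ≤ L := by
    rw [Nat.card_Ioo]
    omega
  omega

lemma grid_index_iff {L N : ℕ} (hL : 1 ≤ L) (hN : L ≤ N) (hN0 : 0 < N) {u w : ℝ}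
    (hw : w ≤ 1) {k : ℕ} (hk : k ∉ exceptionalIndices L N u w) :
    ((k ≤ N - L ∧ (k : ℝ) / N ∈ Set.Icc u w) ↔
      (2 * k ≤ 2 * N - L ∧ ((2 * k : ℕ) : ℝ) / (2 * N) ∈ Set.Icc u w)) ∧
    ((k ≤ N - L ∧ (k : ℝ) / N ∈ Set.Icc u w) ↔
      (2 * k + 1 ≤ 2 * N - L ∧ ((2 * k + 1 : ℕ) : ℝ) / (2 * N) ∈ Set.Icc u w)) := by
  have hNr : (0 : ℝ) < N := by exact_mod_cast hN0
  simp only [exceptionalIndices, Finset.mem_union, Finset.mem_insert, Finset.mem_singleton,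
    Finset.mem_Ioo, not_or, not_and, not_lt] at hk
  obtain ⟨⟨hk1, hk2⟩, hk3⟩ := hk
  simp only [Set.mem_Icc, le_div_iff₀ hNr, div_le_iff₀ hNr,
    le_div_iff₀ (show (0 : ℝ) < 2 * N by linarith), div_le_iff₀ (show (0 : ℝ) < 2 * N by linarith)]
  push_cast
  have b1 : (k : ℝ) ≤ w * N → (k : ℝ) + 1 ≤ w * N := by
    intro h
    have h1 : k ≤ ⌊w * N⌋₊ := Nat.le_floor h
    have h2 : k + 1 ≤ ⌊w * N⌋₊ := by omega
    have h3 : ((⌊w * N⌋₊ : ℕ) : ℝ) ≤ w * N := Nat.floor_le (le_trans (Nat.cast_nonneg k) h)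
    have h4 : ((k + 1 : ℕ) : ℝ) ≤ ⌊w * N⌋₊ := by exact_mod_cast h2
    push_cast at h4
    linarith
  have b2 : u * N < (k : ℝ) + 1 → u * N ≤ k := by
    intro h
    have h1 : ⌈u * N⌉₊ ≤ k + 1 := Nat.ceil_le.mpr (by push_cast; exact h.le)
    have h2 : ⌈u * N⌉₊ ≤ k := by
      omega
    exact Nat.ceil_le.mp h2
  have b3 : k ≤ N - L ∨ N ≤ k := by omega
  have b4 : (N : ℝ) ≤ k ↔ N ≤ k := by exact_mod_cast Iff.rfl
  have b5 : w * N ≤ N := by nlinarith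
  refine ⟨⟨?_, ?_⟩, ⟨?_, ?_⟩⟩
  · rintro ⟨h1, h2, h3⟩
    exact ⟨by omega, by linarith, by linarith⟩
  · rintro ⟨h1, h2, h3⟩
    exact ⟨by omega, by linarith, by linarith⟩
  · rintro ⟨h1, h2, h3⟩
    have := b1 h3
    exact ⟨by omega, by linarith, by linarith⟩
  · rintro ⟨h1, h2, h3⟩
    have := b2 (by linarith)
    exact ⟨by omega, by linarith, by linarith⟩

/-- Comparison of the weighted power sums over `ν_{2N}(I)` and
`ν_N(I)`: there is `c > 0` (not depending on `I` and `N`) such that for every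
compact interval `I = [u,w] ⊆ [0,1]` and every `N ≥ 4` with
`λ(I) ≥ 4(L+1)N^{−1}(log N)²`,
`|Σ_{m∈ν_{2N}(I)} ‖Φ_α(·,H(m/2N))‖^β (2N)^{−βH(m/2N)}
  − 2Σ_{k∈ν_N(I)} ‖Φ_α(·,H(k/N))‖^β (2N)^{−βH(k/N)}|
  ≤ c·N^{−βH̲(I)}·(1 + |ν_N(I)|·N^{−βρ_H}·log N)`. -/
theorem doubled_grid_sum_comparison (α : ℝ)
    (hα : α ∈ Set.Ioo (1 : ℝ) 2) (L : ℕ) (hL : 2 ≤ L) (β : ℝ)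
    (hβ : β ∈ Set.Ioc (0 : ℝ) (1 / 4)) (Hlow Hup : ℝ) (h0 : 1 / α < Hlow)
    (h1 : Hlow ≤ Hup) (h2 : Hup < 1) (H : ℝ → ℝ)
    (hH : ∀ t ∈ Set.Icc (0 : ℝ) 1, H t ∈ Set.Icc Hlow Hup) (cH ρ : ℝ)
    (hcH : 0 < cH) (hρ0 : Hup < ρ) (hρ1 : ρ ≤ 1)
    (hHol : ∀ t₁ ∈ Set.Icc (0 : ℝ) 1, ∀ t₂ ∈ Set.Icc (0 : ℝ) 1,
      |H t₁ - H t₂| ≤ cH * |t₁ - t₂| ^ ρ) :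
    ∃ c > (0 : ℝ), ∀ u w : ℝ, 0 ≤ u → u < w → w ≤ 1 → ∀ N : ℕ, 4 ≤ N →
      4 * ((L : ℝ) + 1) * (Real.log N) ^ 2 / N ≤ w - u →
      let ν : Finset ℕ :=
        (Finset.range (N - L + 1)).filter fun k => (k : ℝ) / N ∈ Set.Icc u w
      let ν2 : Finset ℕ :=
        (Finset.range (2 * N - L + 1)).filter fun m =>
          (m : ℝ) / (2 * N) ∈ Set.Icc u w
      |(∑ m ∈ ν2, PhiNorm α L (H ((m : ℝ) / (2 * N))) ^ β *
            (2 * (N : ℝ)) ^ (-(β * H ((m : ℝ) / (2 * N))))) -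
          2 * ∑ k ∈ ν, PhiNorm α L (H ((k : ℝ) / N)) ^ β *
            (2 * (N : ℝ)) ^ (-(β * H ((k : ℝ) / N)))| ≤
        c * (N : ℝ) ^ (-(β * sInf (H '' Set.Icc u w))) *
          (1 + (ν.card : ℝ) * (N : ℝ) ^ (-(β * ρ)) * Real.log N) := by
  obtain ⟨hα1, -⟩ := hα
  obtain ⟨hβ0, hβ4⟩ := hβ
  have hαpos : 0 < 1 / α := by positivity
  have hlow0 : 0 < Hlow := hαpos.trans h0
  have hρpos : 0 < ρ := by linarith
  obtain ⟨C, hC, hlip⟩ := exists_abs_PhiNorm_sub_le hα1 (by omega : L ≠ 0) h0 h2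
  set B := PhiNorm α L Hlow + C with hB
  have hB0 : 0 < B := add_pos_of_nonneg_of_pos (PhiNorm_nonneg α L Hlow) hC
  have hPB : ∀ v ∈ Set.Icc Hlow Hup, PhiNorm α L v ≤ B := by
    intro v hv
    have h3 := hlip v hv Hlow ⟨le_rfl, h1⟩
    have h4 : |v - Hlow| ≤ 1 := by
      rw [abs_of_nonneg (by linarith [hv.1])]
      linarith [hv.2]
    have h5 := le_of_abs_le h3
    nlinarith
  set K := B ^ β with hK
  have hK0 : 0 < K := Real.rpow_pos_of_pos hB0 _
  set A := (C * cH) ^ β + K * (β * 2) * cH with hA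
  have hA0 : 0 < A := by positivity
  refine ⟨A + (L + 2) * (2 * K), by positivity, fun u w hu huw hw N hN hlen => ?_⟩
  intro ν ν2
  have hN4 : (4 : ℝ) ≤ N := by exact_mod_cast hN
  have hN0 : (0 : ℝ) < N := by linarith
  have hlog : 1 ≤ Real.log N := by
    rw [Real.le_log_iff_exp_le hN0]
    linarith [Real.exp_one_lt_d9]
  have hlog2 : Real.log (2 * N) ≤ 2 * Real.log N := by
    rw [Real.log_mul (by norm_num) hN0.ne']
    have := Real.log_le_log (by norm_num : (0 : ℝ) < 2) (by linarith : (2 : ℝ) ≤ N)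
    linarith
  have hlog20 : 0 ≤ Real.log (2 * N) := Real.log_nonneg (by linarith)
  have hLN : L ≤ N := by
    have h3 : 4 * ((L : ℝ) + 1) * (Real.log N) ^ 2 ≤ N := by
      rw [div_le_iff₀ hN0] at hlen
      nlinarith
    have h4 : (L : ℝ) ≤ N := by
      have h5 : (0 : ℝ) ≤ L := L.cast_nonneg
      have h6 : 1 ≤ Real.log N ^ 2 := one_le_pow₀ hlog
      have h7 := mul_le_mul_of_nonneg_left h6 (by positivity : 0 ≤ 4 * ((L : ℝ) + 1))
      linarith
    exact_mod_cast h4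
  set h := sInf (H '' Set.Icc u w) with hh
  have hI : ∀ t ∈ Set.Icc u w, t ∈ Set.Icc (0 : ℝ) 1 :=
    fun t ht => ⟨hu.trans ht.1, ht.2.trans hw⟩
  have hhle : ∀ t ∈ Set.Icc u w, h ≤ H t := fun t ht => csInf_le
    ⟨Hlow, by rintro _ ⟨s, hs, rfl⟩; exact (hH s (hI s hs)).1⟩ ⟨t, ht, rfl⟩
  have hh0 : 0 ≤ h := hlow0.le.trans <| le_csInf ((Set.nonempty_Icc.mpr huw.le).image H)
    (by rintro _ ⟨s, hs, rfl⟩; exact (hH s (hI s hs)).1)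
  set Q := (N : ℝ) ^ (-(β * h)) with hQ
  have hQ0 : 0 < Q := Real.rpow_pos_of_pos hN0 _
  have hXQ : (2 * (N : ℝ)) ^ (-(β * h)) ≤ Q :=
    Real.rpow_le_rpow_of_nonpos hN0 (by linarith) (by nlinarith)
  have hX1 : (1 : ℝ) ≤ 2 * N := by linarith
  have hpow : ∀ t ∈ Set.Icc u w, (2 * (N : ℝ)) ^ (-(β * H t)) ≤ Q := fun t ht =>
    (Real.rpow_le_rpow_of_exponent_le hX1
      (neg_le_neg (mul_le_mul_of_nonneg_left (hhle t ht) hβ0.le))).trans hXQ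
  have hPK : ∀ t ∈ Set.Icc u w, PhiNorm α L (H t) ^ β ≤ K := fun t ht =>
    Real.rpow_le_rpow (PhiNorm_nonneg _ _ _) (hPB _ (hH t (hI t ht))) hβ0.le
  set R := (N : ℝ) ^ (-(β * ρ)) with hR
  have hR0 : 0 < R := Real.rpow_pos_of_pos hN0 _
  have hHd : ∀ s ∈ Set.Icc u w, ∀ t ∈ Set.Icc u w, |s - t| ≤ 1 / N →
      |H s - H t| ≤ cH * (N : ℝ) ^ (-ρ) := by
    intro s hs t ht hst
    refine (hHol s (hI s hs) t (hI t ht)).trans ?_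
    gcongr
    refine (Real.rpow_le_rpow (abs_nonneg _) hst hρpos.le).trans_eq ?_
    rw [one_div, Real.inv_rpow hN0.le, Real.rpow_neg hN0.le]
  have hRρ : (N : ℝ) ^ (-ρ) ≤ R :=
    Real.rpow_le_rpow_of_exponent_le (by linarith) (by nlinarith)
  have hdiff : ∀ s ∈ Set.Icc u w, ∀ t ∈ Set.Icc u w, |s - t| ≤ 1 / N →
      |PhiNorm α L (H s) ^ β * (2 * (N : ℝ)) ^ (-(β * H s)) -
        PhiNorm α L (H t) ^ β * (2 * (N : ℝ)) ^ (-(β * H t))| ≤ A * Q * R * Real.log N := by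
    intro s hs t ht hst
    have d0 := hHd s hs t ht hst
    have d1 : |PhiNorm α L (H s) ^ β - PhiNorm α L (H t) ^ β| ≤ (C * cH) ^ β * R := by
      refine (abs_rpow_sub_rpow_le_abs_sub_rpow (PhiNorm_nonneg _ _ _) (PhiNorm_nonneg _ _ _)
        hβ0.le (by linarith)).trans ?_
      have d2 : |PhiNorm α L (H s) - PhiNorm α L (H t)| ≤ C * cH * (N : ℝ) ^ (-ρ) := by
        refine (hlip _ (hH s (hI s hs)) _ (hH t (hI t ht))).trans ?_
        rw [mul_assoc]
        gcongr
      refine (Real.rpow_le_rpow (abs_nonneg _) d2 hβ0.le).trans_eq ?_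
      rw [Real.mul_rpow (by positivity) (by positivity), ← Real.rpow_mul hN0.le, hR]
      congr 2
      ring
    have d3 : |(2 * (N : ℝ)) ^ (-(β * H s)) - (2 * (N : ℝ)) ^ (-(β * H t))| ≤
        Q * (β * (2 * Real.log N)) * (cH * R) := by
      refine (abs_rpow_neg_mul_sub_le hX1 hβ0.le (hhle s hs) (hhle t ht)).trans ?_
      gcongr
      exact d0.trans (by gcongr)
    have d4 := hpow s hs
    have d5 := hPK t ht
    have d6 : 0 ≤ (2 * (N : ℝ)) ^ (-(β * H s)) := by positivity
    have d7 : 0 ≤ PhiNorm α L (H t) ^ β := Real.rpow_nonneg (PhiNorm_nonneg _ _ _) _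
    calc _ = |(PhiNorm α L (H s) ^ β - PhiNorm α L (H t) ^ β) * (2 * (N : ℝ)) ^ (-(β * H s)) +
          PhiNorm α L (H t) ^ β *
            ((2 * (N : ℝ)) ^ (-(β * H s)) - (2 * (N : ℝ)) ^ (-(β * H t)))| := by
          congr 1
          ring
      _ ≤ (C * cH) ^ β * R * Q + K * (Q * (β * (2 * Real.log N)) * (cH * R)) := by
          refine (abs_add_le _ _).trans ?_
          rw [abs_mul, abs_mul, abs_of_nonneg d6, abs_of_nonneg d7]
          gcongr
      _ ≤ (C * cH) ^ β * R * Q * Real.log N + K * (Q * (β * (2 * Real.log N)) * (cH * R)) :=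
          add_le_add_left (le_mul_of_one_le_right (by positivity) hlog) _
      _ = _ := by
          rw [hA]
          ring
  have hcast : ∀ k : ℕ, (k : ℝ) / N = ((2 * k : ℕ) : ℝ) / (2 * N) := by
    intro k
    push_cast
    rw [mul_div_mul_left _ _ (by norm_num)]
  have hν : ∀ k, k ∈ ν ↔ k ≤ N - L ∧ (k : ℝ) / N ∈ Set.Icc u w := by
    intro k
    rw [Finset.mem_filter, Finset.mem_range, Nat.lt_succ_iff]
  have hν2 : ∀ m, m ∈ ν2 ↔ m ≤ 2 * N - L ∧ (m : ℝ) / (2 * N) ∈ Set.Icc u w := by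
    intro m
    rw [Finset.mem_filter, Finset.mem_range, Nat.lt_succ_iff]
  have main := abs_sum_sub_two_mul_sum_le (s := ν) (t := ν2) (n := N)
    (E := exceptionalIndices L N u w) (M := K * Q) (δ := A * Q * R * Real.log N)
    (F := fun m => PhiNorm α L (H ((m : ℝ) / (2 * N))) ^ β *
      (2 * (N : ℝ)) ^ (-(β * H ((m : ℝ) / (2 * N)))))
    (by positivity) (by positivity)
    (fun k hk => by
      have := ((hν k).mp hk).1
      rw [Finset.mem_range]
      omega)
    (fun m hm => by
      have := ((hν2 m).mp hm).1
      rw [Finset.mem_range]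
      omega)
    (fun k hk => by
      rw [hν, hcast] at hk
      exact (hν2 _).mpr ⟨by omega, hk.2⟩)
    (fun k hk => by
      rw [hν, hν2, hν2]
      exact grid_index_iff (by omega) hLN (by omega) hw hk)
    (fun m hm => by
      have ht := ((hν2 m).mp hm).2
      have := Real.rpow_nonneg (PhiNorm_nonneg α L (H ((m : ℝ) / (2 * N)))) β
      rw [abs_of_nonneg (by positivity)]
      exact mul_le_mul (hPK _ ht) (hpow _ ht) (by positivity) hK0.le)
    (fun k hk hk' => by
      rw [hν, hcast] at hk
      refine hdiff _ ((hν2 _).mp hk').2 _ hk.2 ?_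
      rw [← sub_div]
      push_cast
      rw [add_sub_cancel_left, abs_of_nonneg (by positivity)]
      exact one_div_le_one_div_of_le hN0 (by linarith))
  simp_rw [hcast]
  refine main.trans ?_
  have hcard : ((exceptionalIndices L N u w).card : ℝ) ≤ L + 2 := by
    exact_mod_cast card_exceptionalIndices_le L N u w
  calc _ ≤ ν.card * (A * Q * R * Real.log N) + (L + 2) * (2 * (K * Q)) := by gcongr
    _ ≤ ν.card * (A * Q * R * Real.log N) + (L + 2) * (2 * (K * Q)) +
        (A * Q + (L + 2) * (2 * K) * Q * (ν.card * R * Real.log N)) :=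
      le_add_of_nonneg_right (by positivity)
    _ = _ := by ring
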